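/- arXiv:1310.5071 — 2 statements merged into one kernel-verified Lean document; each statement's English description precedes it below -/
import Mathlib

section
/- For every n ≥ 1, the automorphism ψⁿ of D is not an inner automorphism: there is no nonzero u ∈ D with ψⁿ(r) = uru⁻¹ for all r ∈ D. -/
/-- `D`, together with the distinguished nonzero elements `x`, `y` satisfying
`x * y = q • (y * x)`, is the `q`-division ring `k_q(x,y)`: the Ore division ring of fractions
of the quantum plane `k_q[x,y]`.  The quantum plane sits inside `D` as the `k`-subalgebra
generated by `x` and `y`; linear independence of the monomials `yⁱxʲ` says that this subalgebra
really is the quantum plane, and `exists_frac` says that `D` is its ring of (left) fractions. -/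
structure IsQDivisionRing (k : Type*) [Field k] (D : Type*) [DivisionRing D] [Algebra k D]
    (q : k) (x y : D) : Prop where
  x_ne_zero : x ≠ 0
  y_ne_zero : y ≠ 0
  rel : x * y = algebraMap k D q * (y * x)
  monomials_linearIndependent :
    LinearIndependent k fun p : ℕ × ℕ => y ^ p.1 * x ^ p.2
  exists_frac : ∀ d : D, ∃ s t : D, s ∈ Algebra.adjoin k ({x, y} : Set D) ∧
    t ∈ Algebra.adjoin k ({x, y} : Set D) ∧ t ≠ 0 ∧ d = t⁻¹ * s

/-- The ordered monomial `yⁱxʲ` attached to the exponent `(i, j)`. -/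
def qMonomial {D : Type*} [DivisionRing D] (x y : D) (p : ℕ × ℕ) : D := y ^ p.1 * x ^ p.2

/-- The span of the ordered monomials with exponents in `P`. -/
def qSpan (k : Type*) [Field k] {D : Type*} [DivisionRing D] [Algebra k D] (x y : D)
    (P : Set (ℕ × ℕ)) : Submodule k D :=
  Submodule.span k (qMonomial x y '' P)

/-- The weight of an exponent: `y` has weight `1` and `x` has weight `√2`, so that distinct
monomials have distinct weights. -/
noncomputable def qWeight (p : ℕ × ℕ) : ℝ := p.1 + p.2 * √2

/-- The element `s` of the quantum plane has leading monomial of weight `g`. -/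
def HasLeadingWeight (k : Type*) [Field k] {D : Type*} [DivisionRing D] [Algebra k D] (x y : D)
    (g : ℝ) (s : D) : Prop :=
  ∃ p : ℕ × ℕ, ∃ c : k, qWeight p = g ∧ c ≠ 0 ∧
    s - c • qMonomial x y p ∈ qSpan k x y {r | qWeight r < g}

/-- The nonzero element `d` of the `q`-division ring has degree `g`, where the degree is the
extension to fractions of the leading weight. -/
def HasDegree (k : Type*) [Field k] {D : Type*} [DivisionRing D] [Algebra k D] (x y : D)
    (g : ℝ) (d : D) : Prop :=
  ∃ e f : ℝ, ∃ s t : D, HasLeadingWeight k x y e s ∧ HasLeadingWeight k x y f t ∧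
    d = t⁻¹ * s ∧ g = e - f

theorem qWeight_add (p r : ℕ × ℕ) : qWeight (p + r) = qWeight p + qWeight r := by
  simp only [qWeight, Prod.fst_add, Prod.snd_add]
  push_cast
  ring

theorem qWeight_injective : Function.Injective qWeight := by
  rintro ⟨a, b⟩ ⟨c, d⟩ h
  simp only [qWeight] at h
  have hbd : b = d := by
    by_contra hne
    have hne' : (b : ℤ) - d ≠ 0 := by omega
    have hirr := irrational_sqrt_two.intCast_mul hne'
    refine hirr.ne_int ((c : ℤ) - a) ?_
    push_cast
    linarith
  subst hbd
  have hac : (a : ℝ) = c := by linarith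
  rw [Nat.cast_injective hac]

namespace IsQDivisionRing

variable {k : Type*} [Field k] {D : Type*} [DivisionRing D] [Algebra k D] {q : k} {x y : D}

theorem x_pow_mul_y_pow (hD : IsQDivisionRing k D q x y) (m n : ℕ) :
    x ^ m * y ^ n = q ^ (m * n) • (y ^ n * x ^ m) := by
  have hrel : x * y = q • (y * x) := by rw [hD.rel, Algebra.smul_def]
  have hx : ∀ n : ℕ, x * y ^ n = q ^ n • (y ^ n * x) := by
    intro n
    induction n with
    | zero => simp
    | succ n ih =>
      rw [pow_succ y, ← mul_assoc, ih, smul_mul_assoc, mul_assoc, hrel, mul_smul_comm, smul_smul,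
        ← pow_succ, mul_assoc]
  induction m with
  | zero => simp
  | succ m ih =>
    rw [pow_succ' x, mul_assoc, ih, mul_smul_comm, ← mul_assoc, hx, smul_mul_assoc, smul_smul,
      mul_assoc, ← pow_add]
    congr 2
    ring

theorem qMonomial_mul (hD : IsQDivisionRing k D q x y) (p r : ℕ × ℕ) :
    qMonomial x y p * qMonomial x y r = q ^ (p.2 * r.1) • qMonomial x y (p + r) := by
  simp only [qMonomial, Prod.fst_add, Prod.snd_add, pow_add]
  calc y ^ p.1 * x ^ p.2 * (y ^ r.1 * x ^ r.2)
      = y ^ p.1 * (x ^ p.2 * y ^ r.1) * x ^ r.2 := by simp only [mul_assoc]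
    _ = _ := by
      rw [hD.x_pow_mul_y_pow, mul_smul_comm, smul_mul_assoc]
      simp only [mul_assoc]

theorem mul_mem_qSpan (hD : IsQDivisionRing k D q x y) {P Q R : Set (ℕ × ℕ)}
    (h : ∀ p ∈ P, ∀ r ∈ Q, p + r ∈ R) {s t : D} (hs : s ∈ qSpan k x y P)
    (ht : t ∈ qSpan k x y Q) : s * t ∈ qSpan k x y R := by
  have hst := Submodule.mul_mem_mul hs ht
  rw [qSpan, qSpan, Submodule.span_mul_span] at hst
  refine Submodule.span_le.2 ?_ hst
  rintro _ ⟨_, ⟨p, hp, rfl⟩, _, ⟨r, hr, rfl⟩, rfl⟩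
  simp only [hD.qMonomial_mul]
  exact Submodule.smul_mem _ _ (Submodule.subset_span ⟨_, h p hp r hr, rfl⟩)

theorem qMonomial_notMem_qSpan (hD : IsQDivisionRing k D q x y) (p : ℕ × ℕ) :
    qMonomial x y p ∉ qSpan k x y {r | qWeight r < qWeight p} :=
  hD.monomials_linearIndependent.notMem_span_image (by simp)

theorem mem_qSpan_univ (hD : IsQDivisionRing k D q x y) {s : D}
    (hs : s ∈ Algebra.adjoin k ({x, y} : Set D)) : s ∈ qSpan k x y Set.univ := by
  have hmon : ∀ p, qMonomial x y p ∈ qSpan k x y Set.univ := fun p =>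
    Submodule.subset_span ⟨p, trivial, rfl⟩
  induction hs using Algebra.adjoin_induction with
  | mem z hz =>
    rcases hz with rfl | rfl
    · simpa [qMonomial] using hmon (0, 1)
    · simpa [qMonomial] using hmon (1, 0)
  | algebraMap c =>
    rw [Algebra.algebraMap_eq_smul_one]
    exact Submodule.smul_mem _ _ (by simpa [qMonomial] using hmon (0, 0))
  | add _ _ _ _ h₁ h₂ => exact add_mem h₁ h₂
  | mul _ _ _ _ h₁ h₂ => exact hD.mul_mem_qSpan (fun _ _ _ _ => Set.mem_univ _) h₁ h₂

end IsQDivisionRing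

theorem qSpan_mono {k : Type*} [Field k] {D : Type*} [DivisionRing D] [Algebra k D] {x y : D}
    {P Q : Set (ℕ × ℕ)} (h : P ⊆ Q) : qSpan k x y P ≤ qSpan k x y Q :=
  Submodule.span_mono (Set.image_mono h)

namespace HasLeadingWeight

variable {k : Type*} [Field k] {D : Type*} [DivisionRing D] [Algebra k D] {q : k} {x y : D}
  {e f : ℝ} {s t : D}

theorem smul_qMonomial (p : ℕ × ℕ) {c : k} (hc : c ≠ 0) :
    HasLeadingWeight k x y (qWeight p) (c • qMonomial x y p) :=
  ⟨p, c, rfl, hc, by simp⟩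

theorem mem_qSpan_of_lt (hs : HasLeadingWeight k x y e s) (h : e < f) :
    s ∈ qSpan k x y {r | qWeight r < f} := by
  obtain ⟨p, c, rfl, -, hs⟩ := hs
  rw [← sub_add_cancel s (c • qMonomial x y p)]
  exact add_mem (qSpan_mono (fun r hr => lt_trans hr h) hs)
    (Submodule.smul_mem _ _ (Submodule.subset_span ⟨p, h, rfl⟩))

theorem notMem_qSpan (hD : IsQDivisionRing k D q x y) (hs : HasLeadingWeight k x y e s) :
    s ∉ qSpan k x y {r | qWeight r < e} := by
  obtain ⟨p, c, rfl, hc, hs⟩ := hs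
  intro h
  have := sub_mem h hs
  rw [sub_sub_cancel] at this
  exact hD.qMonomial_notMem_qSpan p ((Submodule.smul_mem_iff _ hc).1 this)

theorem ne_zero (hD : IsQDivisionRing k D q x y) (hs : HasLeadingWeight k x y e s) : s ≠ 0 := by
  rintro rfl
  exact hs.notMem_qSpan hD (zero_mem _)

theorem unique (hD : IsQDivisionRing k D q x y) (he : HasLeadingWeight k x y e s)
    (hf : HasLeadingWeight k x y f s) : e = f := by
  rcases lt_trichotomy e f with h | h | h
  · exact absurd (he.mem_qSpan_of_lt h) (hf.notMem_qSpan hD)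
  · exact h
  · exact absurd (hf.mem_qSpan_of_lt h) (he.notMem_qSpan hD)

theorem add_of_lt (hs : HasLeadingWeight k x y e s) (ht : HasLeadingWeight k x y f t)
    (h : e < f) : HasLeadingWeight k x y f (s + t) := by
  have hs' := hs.mem_qSpan_of_lt h
  obtain ⟨p, c, hp, hc, ht⟩ := ht
  exact ⟨p, c, hp, hc, by rw [add_sub_assoc]; exact add_mem hs' ht⟩

theorem mul (hD : IsQDivisionRing k D q x y) (hq : q ≠ 0) (hs : HasLeadingWeight k x y e s)
    (ht : HasLeadingWeight k x y f t) : HasLeadingWeight k x y (e + f) (s * t) := by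
  have ht' := ht.mem_qSpan_of_lt (lt_add_one f)
  obtain ⟨p, c, rfl, hc, hs⟩ := hs
  obtain ⟨r, d, rfl, hd, ht⟩ := ht
  refine ⟨p + r, c * d * q ^ (p.2 * r.1), qWeight_add p r,
    mul_ne_zero (mul_ne_zero hc hd) (pow_ne_zero _ hq), ?_⟩
  set a := s - c • qMonomial x y p with ha
  set b := t - d • qMonomial x y r with hb
  have hsum : s * t - (c * d * q ^ (p.2 * r.1)) • qMonomial x y (p + r) =
      a * b + d • (a * qMonomial x y r) + c • (qMonomial x y p * b) := by
    rw [mul_smul, ← hD.qMonomial_mul, ha, hb]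
    simp only [sub_mul, mul_sub, smul_sub, smul_mul_assoc, mul_smul_comm, smul_smul, mul_comm d c]
    abel
  have hself : ∀ p, qMonomial x y p ∈ qSpan k x y {p} := fun p =>
    Submodule.subset_span ⟨p, rfl, rfl⟩
  rw [hsum]
  refine add_mem (add_mem ?_ (Submodule.smul_mem _ _ ?_)) (Submodule.smul_mem _ _ ?_)
  · refine hD.mul_mem_qSpan (fun i hi j hj => ?_) hs ht
    simp only [Set.mem_ofPred_eq, qWeight_add] at *
    linarith
  · refine hD.mul_mem_qSpan (fun i hi j hj => ?_) hs (hself r)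
    rw [Set.mem_singleton_iff] at hj
    simp only [Set.mem_ofPred_eq, qWeight_add, hj] at *
    linarith
  · refine hD.mul_mem_qSpan (fun i hi j hj => ?_) (hself p) ht
    rw [Set.mem_singleton_iff] at hi
    simp only [Set.mem_ofPred_eq, qWeight_add, hi] at *
    linarith

theorem exists_of_ne_zero (hD : IsQDivisionRing k D q x y)
    (hs : s ∈ Algebra.adjoin k ({x, y} : Set D)) (h0 : s ≠ 0) :
    ∃ e, HasLeadingWeight k x y e s := by
  obtain ⟨l, -, rfl⟩ := (Finsupp.mem_span_image_iff_linearCombination k).1 (hD.mem_qSpan_univ hs)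
  have hl : l.support.Nonempty := by
    rw [Finsupp.support_nonempty_iff]
    rintro rfl
    exact h0 (map_zero _)
  obtain ⟨p, hp, hmax⟩ := l.support.exists_max_image qWeight hl
  refine ⟨qWeight p, p, l p, rfl, Finsupp.mem_support_iff.1 hp, ?_⟩
  rw [Finsupp.linearCombination_apply, Finsupp.sum, ← Finset.add_sum_erase _ _ hp,
    add_sub_cancel_left]
  refine sum_mem fun r hr => Submodule.smul_mem _ _ (Submodule.subset_span ⟨r, ?_, rfl⟩)
  rw [Finset.mem_erase] at hr
  exact lt_of_le_of_ne (hmax r hr.2) (qWeight_injective.ne hr.1)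

/-- The left Ore condition, together with the resulting relation between weights. -/
theorem exists_mul_eq_mul (hD : IsQDivisionRing k D q x y) (hq : q ≠ 0)
    (hs : HasLeadingWeight k x y e s) (ht : HasLeadingWeight k x y f t) :
    ∃ a b : D, ∃ α β : ℝ, HasLeadingWeight k x y α a ∧ HasLeadingWeight k x y β b ∧
      a * s = b * t ∧ α + e = β + f := by
  obtain ⟨b, a, hb, ha, ha0, hab⟩ := hD.exists_frac (s * t⁻¹)
  have hs0 := hs.ne_zero hD
  have ht0 := ht.ne_zero hD
  have hb0 : b ≠ 0 := by
    rintro rfl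
    simp [hs0, ht0] at hab
  have heq : a * s = b * t := by
    rw [mul_inv_eq_iff_eq_mul₀ ht0] at hab
    rw [hab, mul_assoc, mul_inv_cancel_left₀ ha0]
  obtain ⟨α, hα⟩ := exists_of_ne_zero hD ha ha0
  obtain ⟨β, hβ⟩ := exists_of_ne_zero hD hb hb0
  refine ⟨a, b, α, β, hα, hβ, heq, unique hD (hα.mul hD hq hs) ?_⟩
  rw [heq]
  exact hβ.mul hD hq ht

end HasLeadingWeight

namespace HasDegree

variable {k : Type*} [Field k] {D : Type*} [DivisionRing D] [Algebra k D] {q : k} {x y : D}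
  {g h : ℝ} {d d' : D}

theorem smul_qMonomial (p : ℕ × ℕ) {c : k} (hc : c ≠ 0) :
    HasDegree k x y (qWeight p) (c • qMonomial x y p) := by
  refine ⟨_, _, _, _, HasLeadingWeight.smul_qMonomial p hc,
    HasLeadingWeight.smul_qMonomial 0 one_ne_zero, ?_, ?_⟩
  · simp [qMonomial]
  · simp [qWeight]

theorem of_x : HasDegree k x y √2 x := by
  simpa [qMonomial, qWeight] using smul_qMonomial (x := x) (y := y) (0, 1) (one_ne_zero (α := k))

theorem of_y : HasDegree k x y 1 y := by
  simpa [qMonomial, qWeight] using smul_qMonomial (x := x) (y := y) (1, 0) (one_ne_zero (α := k))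

theorem algebraMap {c : k} (hc : c ≠ 0) : HasDegree k x y 0 (algebraMap k D c) := by
  simpa [qMonomial, qWeight, Algebra.algebraMap_eq_smul_one] using
    smul_qMonomial (x := x) (y := y) (0, 0) hc

theorem one : HasDegree k x y 0 (1 : D) := by
  simpa using algebraMap (x := x) (y := y) (one_ne_zero (α := k))

theorem inv (hd : HasDegree k x y g d) : HasDegree k x y (-g) d⁻¹ := by
  obtain ⟨e, f, s, t, hs, ht, rfl, rfl⟩ := hd
  exact ⟨f, e, t, s, ht, hs, by simp, by ring⟩

theorem mul (hD : IsQDivisionRing k D q x y) (hq : q ≠ 0) (hd : HasDegree k x y g d)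
    (hd' : HasDegree k x y h d') : HasDegree k x y (g + h) (d * d') := by
  obtain ⟨e, f, s, t, hs, ht, rfl, rfl⟩ := hd
  obtain ⟨e', f', s', t', hs', ht', rfl, rfl⟩ := hd'
  obtain ⟨a, b, α, β, ha, hb, hab, hw⟩ := hs.exists_mul_eq_mul hD hq ht'
  refine ⟨_, _, _, _, hb.mul hD hq hs', ha.mul hD hq ht, ?_, by linarith⟩
  have hst : s * t'⁻¹ = a⁻¹ * b := by
    rw [mul_inv_eq_iff_eq_mul₀ (ht'.ne_zero hD), mul_assoc, ← hab,
      inv_mul_cancel_left₀ (ha.ne_zero hD)]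
  rw [mul_inv_rev, mul_assoc, ← mul_assoc s, hst]
  simp only [mul_assoc]

theorem add_of_lt (hD : IsQDivisionRing k D q x y) (hq : q ≠ 0) (hd : HasDegree k x y g d)
    (hd' : HasDegree k x y h d') (hgh : g < h) : HasDegree k x y h (d + d') := by
  obtain ⟨e, f, s, t, hs, ht, rfl, rfl⟩ := hd
  obtain ⟨e', f', s', t', hs', ht', rfl, rfl⟩ := hd'
  obtain ⟨a, b, α, β, ha, hb, hab, hw⟩ := ht.exists_mul_eq_mul hD hq ht'
  refine ⟨_, _, _, _, (ha.mul hD hq hs).add_of_lt (hb.mul hD hq hs') (by linarith),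
    ha.mul hD hq ht, ?_, by linarith⟩
  rw [mul_add]
  congr 1
  · rw [mul_inv_rev, mul_assoc, inv_mul_cancel_left₀ (ha.ne_zero hD)]
  · rw [hab, mul_inv_rev, mul_assoc, inv_mul_cancel_left₀ (hb.ne_zero hD)]

theorem unique (hD : IsQDivisionRing k D q x y) (hq : q ≠ 0) (hg : HasDegree k x y g d)
    (hh : HasDegree k x y h d) : g = h := by
  obtain ⟨e, f, s, t, hs, ht, rfl, rfl⟩ := hg
  obtain ⟨e', f', s', t', hs', ht', heq, rfl⟩ := hh
  obtain ⟨a, b, α, β, ha, hb, hab, hw⟩ := ht.exists_mul_eq_mul hD hq ht'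
  have hss : a * s = b * s' := by
    rw [← mul_inv_cancel_left₀ (ht.ne_zero hD) s, heq, ← mul_assoc, hab, mul_assoc,
      mul_inv_cancel_left₀ (ht'.ne_zero hD)]
  have has := ha.mul hD hq hs
  rw [hss] at has
  have := has.unique hD (hb.mul hD hq hs')
  linarith

theorem exists_of_ne_zero (hD : IsQDivisionRing k D q x y) (hd : d ≠ 0) :
    ∃ g, HasDegree k x y g d := by
  obtain ⟨s, t, hs, ht, ht0, rfl⟩ := hD.exists_frac d
  obtain ⟨e, he⟩ := HasLeadingWeight.exists_of_ne_zero hD hs (right_ne_zero_of_mul hd)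
  obtain ⟨f, hf⟩ := HasLeadingWeight.exists_of_ne_zero hD ht ht0
  exact ⟨e - f, e, f, s, t, he, hf, rfl, rfl⟩

theorem one_add (hD : IsQDivisionRing k D q x y) (hq : q ≠ 0) (hd : HasDegree k x y g d)
    (hg : 0 < g) : HasDegree k x y g (1 + d) :=
  one.add_of_lt hD hq hd hg

end HasDegree

theorem hasDegree_pow_apply {k : Type*} [Field k] {D : Type*} [DivisionRing D] [Algebra k D]
    {q : k} {x y : D} (hD : IsQDivisionRing k D q x y) (hq : q ≠ 0) {ψ : D ≃ₐ[k] D}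
    (hψx : ψ x = x + algebraMap k D q * y * ((1 + y)⁻¹ * (1 + algebraMap k D q * y)⁻¹) * x ^ 2)
    (hψy : ψ y = y + algebraMap k D q * y * (1 + y)⁻¹ * x) (n : ℕ) :
    HasDegree k x y (√2 + n * (√2 - 1)) ((ψ ^ n) x) ∧
      HasDegree k x y (1 + n * (√2 - 1)) ((ψ ^ n) y) := by
  have h2 : (1 : ℝ) < √2 := Real.one_lt_sqrt_two
  induction n with
  | zero => simpa using ⟨HasDegree.of_x, HasDegree.of_y⟩
  | succ n ih =>
    obtain ⟨hX, hY⟩ := ih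
    have hpos : 0 < 1 + (n : ℝ) * (√2 - 1) := by
      have : 0 ≤ (n : ℝ) * (√2 - 1) := mul_nonneg n.cast_nonneg (by linarith)
      linarith
    have hqY : HasDegree k x y (1 + n * (√2 - 1)) (algebraMap k D q * (ψ ^ n) y) := by
      simpa using (HasDegree.algebraMap hq).mul hD hq hY
    have hY1 := (hY.one_add hD hq hpos).inv
    have hqY1 := (hqY.one_add hD hq hpos).inv
    have hX' := hX.add_of_lt hD hq
      ((hqY.mul hD hq (hY1.mul hD hq hqY1)).mul hD hq (hX.mul hD hq hX)) (by linarith)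
    have hY' := hY.add_of_lt hD hq ((hqY.mul hD hq hY1).mul hD hq hX) (by linarith)
    rw [pow_succ, AlgEquiv.mul_apply, AlgEquiv.mul_apply, hψx, hψy]
    simp only [map_add, map_mul, map_pow, map_inv₀, map_one, AlgEquiv.commutes]
    constructor
    · convert hX' using 1
      · push_cast; ring
      · rw [sq]
    · convert hY' using 1
      push_cast; ring

/-- Suppose `q` is not a root of unity, and let `ψ` be the `k`-algebra automorphism of `D`
with `ψ(x) = x + qy(1+y)⁻¹(1+qy)⁻¹x²` and `ψ(y) = y + qy(1+y)⁻¹x`.  For every `n ≥ 1`, the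
automorphism `ψⁿ` of `D` is not inner: there is no nonzero `u ∈ D` with `ψⁿ(r) = uru⁻¹` for
all `r ∈ D`. -/
theorem stmt18 (k : Type*) [Field k] [CharZero k] (q : k) (hq : q ≠ 0)
    (hq' : ∀ n : ℕ, 0 < n → q ^ n ≠ 1)
    (D : Type*) [DivisionRing D] [Algebra k D] (x y : D)
    (hD : IsQDivisionRing k D q x y)
    (ψ : D ≃ₐ[k] D)
    (hψx : ψ x = x + algebraMap k D q * y * ((1 + y)⁻¹ * (1 + algebraMap k D q * y)⁻¹) * x ^ 2)
    (hψy : ψ y = y + algebraMap k D q * y * (1 + y)⁻¹ * x) :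
    ∀ n : ℕ, 1 ≤ n →
      ¬ ∃ u : D, u ≠ 0 ∧ ∀ r : D, (ψ ^ n) r = u * r * u⁻¹ := by
  rintro n hn ⟨u, hu, h⟩
  have hY := (hasDegree_pow_apply hD hq hψx hψy n).2
  obtain ⟨g, hg⟩ := HasDegree.exists_of_ne_zero hD hu
  rw [h y] at hY
  have heq := hY.unique hD hq ((hg.mul hD hq HasDegree.of_y).mul hD hq hg.inv)
  have hlt : 0 < (n : ℝ) * (√2 - 1) :=
    mul_pos (by exact_mod_cast hn) (sub_pos.2 Real.one_lt_sqrt_two)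
  linarith
end

section
/- Let α be a k-algebra automorphism of D. Suppose α fixes some element r ∈ D not in k, and that there is a product φ' of elementary automorphisms of D such that r is the image of x or of y under φ'. Then α is a product of elementary automorphisms of D; explicitly, α = φ'∘h∘φ'⁻¹ for some elementary automorphism h. -/
/-- `MemDivisionClosure k s d` says that `d` lies in the division subring of `D`
generated over `k` by the set `s`. -/
inductive MemDivisionClosure (k : Type*) [Field k] {D : Type*} [DivisionRing D] [Algebra k D]
    (s : Set D) : D → Prop
  | mem {a : D} : a ∈ s → MemDivisionClosure k s a
  | scalar (c : k) : MemDivisionClosure k s (algebraMap k D c)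
  | add {a b : D} : MemDivisionClosure k s a → MemDivisionClosure k s b →
      MemDivisionClosure k s (a + b)
  | neg {a : D} : MemDivisionClosure k s a → MemDivisionClosure k s (-a)
  | mul {a b : D} : MemDivisionClosure k s a → MemDivisionClosure k s b →
      MemDivisionClosure k s (a * b)
  | inv {a : D} : MemDivisionClosure k s a → MemDivisionClosure k s a⁻¹

/-- With respect to the generators `x`, `y` of `D`, the *elementary automorphisms* of `D` are
`τ : x ↦ x⁻¹, y ↦ y⁻¹`; the maps `x ↦ b(y)x, y ↦ y` for nonzero `b(y)` in the subfield `k(y)`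
of `D`; and the maps `x ↦ x, y ↦ a(x)y` for nonzero `a(x)` in the subfield `k(x)` of `D`. -/
def IsElementary (k : Type*) [Field k] {D : Type*} [DivisionRing D] [Algebra k D]
    (x y : D) (α : D ≃ₐ[k] D) : Prop :=
  (α x = x⁻¹ ∧ α y = y⁻¹) ∨
  (∃ b : D, MemDivisionClosure k ({y} : Set D) b ∧ b ≠ 0 ∧ α x = b * x ∧ α y = y) ∨
  (∃ a : D, MemDivisionClosure k ({x} : Set D) a ∧ a ≠ 0 ∧ α x = x ∧ α y = a * y)

section Centralizer

variable {k : Type*} [Field k] {D : Type*} [DivisionRing D] [Algebra k D]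

theorem MemDivisionClosure.commute {y a : D} (h : MemDivisionClosure k ({y} : Set D) a) :
    Commute y a := by
  induction h with
  | mem h => rw [Set.mem_singleton_iff.mp h]
  | scalar c => exact (Algebra.commutes c y).symm
  | add _ _ h₁ h₂ => exact h₁.add_right h₂
  | neg _ h => exact h.neg_right
  | mul _ _ h₁ h₂ => exact h₁.mul_right h₂
  | inv _ h => exact h.inv_right₀

theorem MemDivisionClosure.conj {y u a : D} (h : MemDivisionClosure k ({y} : Set D) a)
    (hu : u ≠ 0) (huy : MemDivisionClosure k ({y} : Set D) (u * y * u⁻¹)) :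
    MemDivisionClosure k ({y} : Set D) (u * a * u⁻¹) := by
  induction h with
  | mem h => rwa [Set.mem_singleton_iff.mp h]
  | scalar c =>
    rw [← Algebra.commutes, mul_assoc, mul_inv_cancel₀ hu, mul_one]
    exact .scalar c
  | add _ _ h₁ h₂ => rw [mul_add, add_mul]; exact h₁.add h₂
  | neg _ h => rw [mul_neg, neg_mul]; exact h.neg
  | @mul a b _ _ h₁ h₂ =>
    have : u * (a * b) * u⁻¹ = (u * a * u⁻¹) * (u * b * u⁻¹) := by
      simp only [mul_assoc, inv_mul_cancel_left₀ hu]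
    rw [this]; exact h₁.mul h₂
  | @inv a _ h =>
    have : u * a⁻¹ * u⁻¹ = (u * a * u⁻¹)⁻¹ := by
      simp only [mul_inv_rev, inv_inv, mul_assoc]
    rw [this]; exact h.inv

theorem pow_mul_eq_of_mul_eq {q : k} {x y : D} (rel : x * y = algebraMap k D q * (y * x))
    (n : ℕ) : x ^ n * y = algebraMap k D (q ^ n) * (y * x ^ n) := by
  induction n with
  | zero => simp
  | succ n ih =>
    calc x ^ (n + 1) * y = x ^ n * (x * y) := by rw [pow_succ, mul_assoc]
      _ = algebraMap k D q * (x ^ n * y) * x := by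
        rw [rel, ← mul_assoc, ← Algebra.commutes]; simp only [mul_assoc]
      _ = _ := by
        rw [ih, pow_succ q, mul_comm (q ^ n), map_mul, pow_succ x]; simp only [mul_assoc]

variable {q : k} {x y : D}

theorem memDivisionClosure_pow_conj (hx : x ≠ 0) (rel : x * y = algebraMap k D q * (y * x))
    (n : ℕ) {a : D} (h : MemDivisionClosure k ({y} : Set D) a) :
    MemDivisionClosure k ({y} : Set D) (x ^ n * a * (x ^ n)⁻¹) := by
  refine h.conj (pow_ne_zero n hx) ?_
  rw [pow_mul_eq_of_mul_eq rel, mul_assoc, mul_assoc, mul_inv_cancel₀ (pow_ne_zero n hx), mul_one]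
  exact .mul (.scalar _) (.mem rfl)

theorem memDivisionClosure_pow_inv_conj (hq : q ≠ 0) (hx : x ≠ 0)
    (rel : x * y = algebraMap k D q * (y * x))
    (n : ℕ) {a : D} (h : MemDivisionClosure k ({y} : Set D) a) :
    MemDivisionClosure k ({y} : Set D) ((x ^ n)⁻¹ * a * x ^ n) := by
  have hn := pow_ne_zero n hx
  have key : (x ^ n)⁻¹ * y * x ^ n = algebraMap k D (q ^ n)⁻¹ * y := by
    have hc : algebraMap k D (q ^ n)⁻¹ * algebraMap k D (q ^ n) = 1 := by
      rw [← map_mul, inv_mul_cancel₀ (pow_ne_zero n hq), map_one]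
    rw [mul_assoc, inv_mul_eq_iff_eq_mul₀ hn, ← mul_assoc (x ^ n), ← Algebra.commutes,
      mul_assoc, pow_mul_eq_of_mul_eq rel, ← mul_assoc, hc, one_mul]
  have := h.conj (u := (x ^ n)⁻¹) (inv_ne_zero hn) (by
    rw [inv_inv, key]; exact .mul (.scalar _) (.mem rfl))
  rwa [inv_inv] at this

theorem exists_finsupp_of_mem_adjoin (hx : x ≠ 0) (rel : x * y = algebraMap k D q * (y * x))
    {t : D} (ht : t ∈ Algebra.adjoin k ({x, y} : Set D)) :
    ∃ f : ℕ →₀ D, (∀ j, MemDivisionClosure k ({y} : Set D) (f j)) ∧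
      t = f.sum fun j a => a * x ^ j := by
  have zero_mem : MemDivisionClosure k ({y} : Set D) 0 := by
    simpa using MemDivisionClosure.scalar (s := ({y} : Set D)) (0 : k)
  have one_mem : MemDivisionClosure k ({y} : Set D) 1 := by
    simpa using MemDivisionClosure.scalar (s := ({y} : Set D)) (1 : k)
  have monomial : ∀ m ∈ Submonoid.closure ({x, y} : Set D),
      ∃ (a : D) (j : ℕ), MemDivisionClosure k ({y} : Set D) a ∧ m = a * x ^ j := by
    intro m hm
    induction hm using Submonoid.closure_induction with
    | mem m hm =>
      rcases hm with rfl | rfl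
      · exact ⟨1, 1, one_mem, by simp⟩
      · exact ⟨m, 0, .mem rfl, by simp⟩
    | one => exact ⟨1, 0, one_mem, by simp⟩
    | mul m₁ m₂ _ _ h₁ h₂ =>
      obtain ⟨a, i, ha, rfl⟩ := h₁
      obtain ⟨b, j, hb, rfl⟩ := h₂
      refine ⟨a * (x ^ i * b * (x ^ i)⁻¹), i + j,
        ha.mul (memDivisionClosure_pow_conj hx rel i hb), ?_⟩
      simp only [pow_add, mul_assoc, inv_mul_cancel_left₀ (pow_ne_zero i hx)]
  rw [← Subalgebra.mem_toSubmodule, Algebra.adjoin_eq_span] at ht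
  induction ht using Submodule.span_induction with
  | mem m hm =>
    obtain ⟨a, j, ha, rfl⟩ := monomial m hm
    refine ⟨Finsupp.single j a, fun i => ?_, by simp⟩
    rw [Finsupp.single_apply]
    split_ifs
    exacts [ha, zero_mem]
  | zero => exact ⟨0, fun _ => zero_mem, by simp⟩
  | add s t _ _ hs ht =>
    obtain ⟨f, hf, rfl⟩ := hs
    obtain ⟨g, hg, rfl⟩ := ht
    refine ⟨f + g, fun j => (hf j).add (hg j), ?_⟩
    rw [Finsupp.sum_add_index'] <;> simp [add_mul]
  | smul c s _ hs =>
    obtain ⟨f, hf, rfl⟩ := hs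
    refine ⟨c • f, fun j => ?_, ?_⟩
    · rw [Finsupp.smul_apply, Algebra.smul_def]
      exact .mul (.scalar c) (hf j)
    · rw [Finsupp.sum_smul_index' (by simp), Finsupp.smul_sum]
      simp

theorem eq_of_sum_eq_sum_of_mul_eq (hq : q ≠ 0) (hq' : ∀ n : ℕ, 0 < n → q ^ n ≠ 1)
    (hy : y ≠ 0) {u v : ℕ → D}
    (hu : ∀ j, u j * y = algebraMap k D (q ^ j) * (y * u j))
    (hv : ∀ j, v j * y = algebraMap k D (q ^ j) * (y * v j))
    {s : Finset ℕ} (h : ∑ j ∈ s, u j = ∑ j ∈ s, v j) {j : ℕ} (hj : j ∈ s) : u j = v j := by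
  let T : Module.End k D := LinearMap.mulLeft k y⁻¹ ∘ₗ LinearMap.mulRight k y
  have hinj : Function.Injective fun j : ℕ => q ^ j := by
    refine Function.Injective.of_lt_imp_ne fun i j hij he => hq' (j - i) (Nat.sub_pos_of_lt hij) ?_
    have : q ^ i * q ^ (j - i) = q ^ i * 1 := by
      rw [← pow_add, Nat.add_sub_cancel' hij.le, mul_one]; exact he.symm
    exact mul_left_cancel₀ (pow_ne_zero i hq) this
  have hind := (Module.End.eigenspaces_iSupIndep T).comp hinj
  have eigen : ∀ {w : D} {j : ℕ}, w * y = algebraMap k D (q ^ j) * (y * w) →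
      w ∈ T.eigenspace (q ^ j) := by
    intro w j hw
    rw [Module.End.mem_eigenspace_iff]
    change y⁻¹ * (w * y) = q ^ j • w
    rw [hw, ← mul_assoc, ← Algebra.commutes, mul_assoc, inv_mul_cancel_left₀ hy, Algebra.smul_def]
  have hsum : ∑ j ∈ s, (u j - v j) = 0 := by rw [Finset.sum_sub_distrib, h, sub_self]
  exact sub_eq_zero.mp (iSupIndep_iff_finsetSum_eq_zero_imp_eq_zero _ |>.mp hind s
    (fun j => u j - v j) (fun j _ => sub_mem (eigen (hu j)) (eigen (hv j))) hsum j hj)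

/-- The centralizer of `y` in the `q`-division ring is the subfield `k(y)`. -/
theorem memDivisionClosure_of_commute (hq : q ≠ 0) (hq' : ∀ n : ℕ, 0 < n → q ^ n ≠ 1)
    (hx : x ≠ 0) (hy : y ≠ 0) (rel : x * y = algebraMap k D q * (y * x)) {d s t : D}
    (hs : s ∈ Algebra.adjoin k ({x, y} : Set D)) (ht : t ∈ Algebra.adjoin k ({x, y} : Set D))
    (ht0 : t ≠ 0) (hd : d = t⁻¹ * s) (hc : Commute y d) :
    MemDivisionClosure k ({y} : Set D) d := by
  obtain ⟨f, hf, rfl⟩ := exists_finsupp_of_mem_adjoin hx rel ht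
  obtain ⟨g, hg, rfl⟩ := exists_finsupp_of_mem_adjoin hx rel hs
  have eigen : ∀ {a : D} (j : ℕ), MemDivisionClosure k ({y} : Set D) a →
      a * x ^ j * y = algebraMap k D (q ^ j) * (y * (a * x ^ j)) := by
    intro a j ha
    rw [mul_assoc, pow_mul_eq_of_mul_eq rel, ← mul_assoc, ← Algebra.commutes, mul_assoc,
      ← mul_assoc a, ← ha.commute.eq, mul_assoc]
  obtain ⟨j, hj, hfj⟩ := Finset.exists_ne_zero_of_sum_ne_zero ht0
  have hsum : ∑ i ∈ f.support ∪ g.support, f i * x ^ i * d =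
      ∑ i ∈ f.support ∪ g.support, g i * x ^ i := by
    rw [eq_inv_mul_iff_mul_eq₀ ht0, f.sum_of_support_subset Finset.subset_union_left _ (by simp),
      g.sum_of_support_subset Finset.subset_union_right _ (by simp), Finset.sum_mul] at hd
    exact hd
  have h := eq_of_sum_eq_sum_of_mul_eq hq hq' hy (u := fun i => f i * x ^ i * d)
    (v := fun i => g i * x ^ i)
    (fun i => by
      rw [mul_assoc, ← hc.eq, ← mul_assoc, eigen i (hf i)]
      simp only [mul_assoc])
    (fun i => eigen i (hg i)) hsum (Finset.mem_union_left _ hj)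
  have hd' : d = (x ^ j)⁻¹ * ((f j)⁻¹ * g j) * x ^ j := by
    rw [← eq_inv_mul_iff_mul_eq₀ hfj] at h
    rw [h, mul_inv_rev]
    simp only [mul_assoc]
  rw [hd']
  exact memDivisionClosure_pow_inv_conj hq hx rel j ((hf j).inv.mul (hg j))

/-- An algebra automorphism of the `q`-division ring fixing `y` sends `x` to `b(y)x`. -/
theorem exists_memDivisionClosure_of_map_eq (hq : q ≠ 0) (hq' : ∀ n : ℕ, 0 < n → q ^ n ≠ 1)
    (hx : x ≠ 0) (hy : y ≠ 0) (rel : x * y = algebraMap k D q * (y * x))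
    (hfrac : ∀ d : D, ∃ s t : D, s ∈ Algebra.adjoin k ({x, y} : Set D) ∧
      t ∈ Algebra.adjoin k ({x, y} : Set D) ∧ t ≠ 0 ∧ d = t⁻¹ * s)
    (β : D ≃ₐ[k] D) (hβ : β y = y) :
    ∃ b : D, MemDivisionClosure k ({y} : Set D) b ∧ b ≠ 0 ∧ β x = b * x := by
  obtain ⟨s, t, hs, ht, ht0, hd⟩ := hfrac (β x * x⁻¹)
  have hβrel : β x * y = algebraMap k D q * (y * β x) := by
    simpa [hβ] using congrArg β rel
  refine ⟨β x * x⁻¹, memDivisionClosure_of_commute hq hq' hx hy rel hs ht ht0 hd ?_,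
    mul_ne_zero (by simpa using hx) (inv_ne_zero hx), (inv_mul_cancel_right₀ hx _).symm⟩
  have hq0 : algebraMap k D q ≠ 0 := by simpa using hq
  have hconj : y * x⁻¹ = x⁻¹ * (algebraMap k D q * y) := by
    rw [eq_inv_mul_iff_mul_eq₀ hx, ← mul_assoc, rel, mul_assoc, mul_assoc, mul_inv_cancel₀ hx,
      mul_one]
  refine mul_left_cancel₀ hq0 ?_
  calc algebraMap k D q * (y * (β x * x⁻¹)) = β x * (y * x⁻¹) := by
        rw [← mul_assoc (β x), hβrel]; simp only [mul_assoc]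
    _ = β x * x⁻¹ * (algebraMap k D q * y) := by rw [hconj, mul_assoc]
    _ = algebraMap k D q * (β x * x⁻¹ * y) := by
        rw [← mul_assoc, ← Algebra.commutes, mul_assoc]

end Centralizer

/-- Suppose `q` is not a root of unity.  Let `α` be a `k`-algebra automorphism of `D` fixing
some element `r ∈ D` not in `k`, and suppose there is a product `φ'` of elementary
automorphisms of `D` such that `r` is the image of `x` or of `y` under `φ'`.  Then `α` is a
product of elementary automorphisms of `D`; explicitly, `α = φ' ∘ h ∘ φ'⁻¹` for some
elementary automorphism `h`. -/
theorem stmt19 (k : Type*) [Field k] [CharZero k] (q : k) (hq : q ≠ 0)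
    (hq' : ∀ n : ℕ, 0 < n → q ^ n ≠ 1)
    (D : Type*) [DivisionRing D] [Algebra k D] (x y : D)
    (hD : IsQDivisionRing k D q x y)
    (α : D ≃ₐ[k] D) (r : D)
    (hr : r ∉ Set.range (algebraMap k D)) (hfix : α r = r)
    (φ' : D ≃ₐ[k] D)
    (hφ' : φ' ∈ Submonoid.closure {e : D ≃ₐ[k] D | IsElementary k x y e})
    (him : φ' x = r ∨ φ' y = r) :
    ∃ h : D ≃ₐ[k] D, IsElementary k x y h ∧
      (∀ d : D, α d = φ' (h (φ'.symm d))) ∧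
      α ∈ Subgroup.closure {e : D ≃ₐ[k] D | IsElementary k x y e} := by
  have hβ : ∀ z, φ' z = r → (φ'⁻¹ * α * φ') z = z := by
    intro z hz
    change φ'.symm (α (φ' z)) = z
    rw [hz, hfix, ← hz, AlgEquiv.symm_apply_apply]
  have helem : IsElementary k x y (φ'⁻¹ * α * φ') := by
    rcases him with h | h
    · have rel : y * x = algebraMap k D q⁻¹ * (x * y) := by
        rw [hD.rel, ← mul_assoc, ← map_mul, inv_mul_cancel₀ hq, map_one, one_mul]
      have hfrac := hD.exists_frac
      rw [Set.pair_comm] at hfrac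
      obtain ⟨a, ha, ha0, hay⟩ := exists_memDivisionClosure_of_map_eq (inv_ne_zero hq)
        (fun n hn => by rw [inv_pow]; exact inv_ne_one.mpr (hq' n hn))
        hD.y_ne_zero hD.x_ne_zero rel hfrac _ (hβ x h)
      exact .inr (.inr ⟨a, ha, ha0, hβ x h, hay⟩)
    · obtain ⟨b, hb, hb0, hbx⟩ := exists_memDivisionClosure_of_map_eq hq hq'
        hD.x_ne_zero hD.y_ne_zero hD.rel hD.exists_frac _ (hβ y h)
      exact .inr (.inl ⟨b, hb, hb0, hbx, hβ y h⟩)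
  have hα : α = φ' * (φ'⁻¹ * α * φ') * φ'⁻¹ := by group
  refine ⟨φ'⁻¹ * α * φ', helem, fun d => DFunLike.congr_fun hα d, ?_⟩
  have hφ : φ' ∈ Subgroup.closure {e : D ≃ₐ[k] D | IsElementary k x y e} :=
    Subgroup.le_closure_toSubmonoid _ hφ'
  rw [hα]
  exact mul_mem (mul_mem hφ (Subgroup.subset_closure helem)) (inv_mem hφ)
end
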